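/- Let (X, d, μ) be a metric measure space whose measure is Ahlfors ν-regular with constants 0 < c₁ ≤ c₂ < ∞ satisfying 2^{1−ν}·(c₂/c₁) < 1, and let K be a kernel satisfying the size condition and the pseudo-radial null condition. Let f : X → ℝ be locally integrable and let g : X → [0,∞] be locally integrable such that the pair (f, g) satisfies a weak (1, ρ')-Poincaré–Sobolev inequality for some 1 < ρ' < ν. Suppose g belongs to the Morrey space M^{p,q}_μ(X) for some 1 < p ≤ q < ∞ with q/ν < 1, and let 1 < r < ∞ be an exponent with (1 − q/ν)·r > 1 such that g ∈ L^{(1−q/ν)r}(μ). Then there is a constant C such that ‖T*_K f‖_{L^r(μ)} ≤ C · ‖g‖_{L^{(1−q/ν)r}(μ)}^{1 − q/ν} · ‖g‖_{M^{p,q}}^{q/ν}. -/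

import Mathlib

open MeasureTheory Metric ENNReal

variable {X : Type*} [MetricSpace X] [MeasurableSpace X] [BorelSpace X]

/-- Riesz-type potential `R_{s,μ} g (x) = ∫ d(x,y)^s / μ(B(x,d(x,y))) · g(y) dμ(y)`,
for `g : X → [0,∞]`, valued in `[0,∞]`. -/
noncomputable def rieszPot (μ : Measure X) (s : ℝ) (g : X → ℝ≥0∞) (x : X) : ℝ≥0∞ :=
  ∫⁻ y, (ENNReal.ofReal (dist x y ^ s) / μ (ball x (dist x y))) * g y ∂μ

/-- Riesz-type potential applied to a real (signed) function, as a Bochner integral. -/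
noncomputable def rieszR (μ : Measure X) (s : ℝ) (f : X → ℝ) (x : X) : ℝ :=
  ∫ y, (dist x y ^ s / (μ (ball x (dist x y))).toReal) * f y ∂μ

/-- Hardy–Littlewood maximal function: sup over open balls containing `x`. -/
noncomputable def maximalFn (μ : Measure X) (g : X → ℝ≥0∞) (x : X) : ℝ≥0∞ :=
  ⨆ (z : X) (r : ℝ) (_ : 0 < r) (_ : x ∈ ball z r),
    (μ (ball z r))⁻¹ * ∫⁻ y in ball z r, g y ∂μ

/-- Morrey norm `‖g‖_{M^{p,q}}`, valued in `[0,∞]`. -/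
noncomputable def morreyNorm (μ : Measure X) (p q : ℝ) (g : X → ℝ≥0∞) : ℝ≥0∞ :=
  ⨆ (z : X) (r : ℝ) (_ : 0 < r),
    (μ (ball z r) ^ (p / q - 1) * ∫⁻ y in ball z r, g y ^ p ∂μ) ^ (1 / p)

/-- Truncated singular integral `T^ε_K f (x)`. -/
noncomputable def truncT (μ : Measure X) (K : X → X → ℝ) (f : X → ℝ) (ε : ℝ) (x : X) : ℝ :=
  ∫ y in {y | ε < dist x y}, K x y * f y ∂μ

/-- Maximal singular operator `T^*_K f (x) = sup_{ε>0} |T^ε_K f (x)|`, valued in `[0,∞]`. -/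
noncomputable def maxT (μ : Measure X) (K : X → X → ℝ) (f : X → ℝ) (x : X) : ℝ≥0∞ :=
  ⨆ (ε : ℝ) (_ : 0 < ε), ENNReal.ofReal |truncT μ K f ε x|

/-- Ahlfors `ν`-regularity: `c₁ r^ν ≤ μ(B(x,r)) ≤ c₂ r^ν`. -/
def IsAhlfors (μ : Measure X) (c₁ c₂ ν : ℝ) : Prop :=
  ∀ (x : X) (r : ℝ), 0 < r →
    ENNReal.ofReal (c₁ * r ^ ν) ≤ μ (ball x r) ∧ μ (ball x r) ≤ ENNReal.ofReal (c₂ * r ^ ν)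

/-- Size condition on the kernel: `|K(x,y)| ≤ C_K / d(x,y)^ν` for `x ≠ y`. -/
def SizeCond (K : X → X → ℝ) (CK ν : ℝ) : Prop :=
  ∀ x y : X, x ≠ y → |K x y| ≤ CK / dist x y ^ ν

/-- Pseudo-radial null condition: `∫_{a < d(x,y) < b} K(x,y) dμ(y) = 0`. -/
def NullCond (μ : Measure X) (K : X → X → ℝ) : Prop :=
  ∀ (x : X) (a b : ℝ), 0 < a → a < b →
    ∫ y in {y | a < dist x y ∧ dist x y < b}, K x y ∂μ = 0

/-- Weak `(1,ρ')`-Poincaré–Sobolev inequality for the pair `(f,g)` with constants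
`C_P > 0` and dilation `σ`. -/
def PoincareSobolev (μ : Measure X) (f : X → ℝ) (g : X → ℝ≥0∞) (ρ' CP σ : ℝ) : Prop :=
  ∀ (x : X) (r : ℝ), 0 < r →
    ((μ (ball x r))⁻¹ *
        ∫⁻ y in ball x r, ENNReal.ofReal (|f y - ⨍ z in ball x r, f z ∂μ| ^ ρ') ∂μ) ^ (1 / ρ')
      ≤ ENNReal.ofReal (CP * r) *
        ((μ (ball x (σ * r)))⁻¹ * ∫⁻ y in ball x (σ * r), g y ∂μ)

/-- Local integrability for an `[0,∞]`-valued function: measurable with finite integral on balls. -/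
def LocIntE (μ : Measure X) (g : X → ℝ≥0∞) : Prop :=
  Measurable g ∧ ∀ (z : X) (r : ℝ), ∫⁻ y in ball z r, g y ∂μ < ∞

/-- `L^r` norm (in `[0,∞]`) of an `[0,∞]`-valued function. -/
noncomputable def lpNormE (μ : Measure X) (r : ℝ) (h : X → ℝ≥0∞) : ℝ≥0∞ :=
  (∫⁻ x, h x ^ r ∂μ) ^ (1 / r)

/-- Lorentz `L^{r,m}` quasinorm (in `[0,∞]`) of an `[0,∞]`-valued function. -/
noncomputable def lorentzNormE (μ : Measure X) (r m : ℝ) (h : X → ℝ≥0∞) : ℝ≥0∞ :=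
  ENNReal.ofReal (r ^ (1 / m)) *
    (∫⁻ α in Set.Ioi (0 : ℝ),
        (ENNReal.ofReal α * μ {x | ENNReal.ofReal α < h x} ^ (1 / r)) ^ m *
          ENNReal.ofReal α⁻¹) ^ (1 / m)


omit [BorelSpace X] in
theorem IsAhlfors.measure_ball_pos {μ : Measure X} {c₁ c₂ ν : ℝ} (hA : IsAhlfors μ c₁ c₂ ν)
    (hc₁ : 0 < c₁) (x : X) {r : ℝ} (hr : 0 < r) : 0 < μ (ball x r) :=
  lt_of_lt_of_le (ENNReal.ofReal_pos.2 (by positivity)) (hA x r hr).1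

omit [BorelSpace X] in
theorem IsAhlfors.measure_ball_lt_top {μ : Measure X} {c₁ c₂ ν : ℝ} (hA : IsAhlfors μ c₁ c₂ ν)
    (x : X) (r : ℝ) : μ (ball x r) < ∞ := by
  rcases le_or_gt r 0 with hr | hr
  · simp [ball_eq_empty.2 hr]
  · exact (hA x r hr).2.trans_lt ENNReal.ofReal_lt_top

omit [BorelSpace X] in
theorem IsAhlfors.sigmaFinite {μ : Measure X} {c₁ c₂ ν : ℝ} (hA : IsAhlfors μ c₁ c₂ ν) :
    SigmaFinite μ := by
  rcases isEmpty_or_nonempty X with h | ⟨⟨x⟩⟩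
  · rw [Measure.eq_zero_of_isEmpty μ]
    infer_instance
  · exact ⟨⟨⟨fun n : ℕ => ball x n, fun _ => trivial, fun n => hA.measure_ball_lt_top x n,
      iUnion_ball_nat x⟩⟩⟩

theorem IsAhlfors.countable_of_pairwiseDisjoint_ball {μ : Measure X} {c₁ c₂ ν : ℝ}
    (hA : IsAhlfors μ c₁ c₂ ν) (hc₁ : 0 < c₁) {ι : Type*} {u : Set ι} {z : ι → X} {ρ : ι → ℝ}
    (hρ : ∀ a ∈ u, 0 < ρ a) (hu : u.PairwiseDisjoint fun a => ball (z a) (ρ a)) :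
    u.Countable := by
  have := hA.sigmaFinite
  have h := Measure.countable_meas_pos_of_disjoint_iUnion (μ := μ)
    (As := fun a : u => ball (z a) (ρ a)) (fun _ => measurableSet_ball)
    (fun a b hab => hu a.2 b.2 (fun h => hab (Subtype.ext h)))
  have h' : {a : u | 0 < μ (ball (z a) (ρ a))} = Set.univ :=
    Set.eq_univ_of_forall fun a => hA.measure_ball_pos hc₁ _ (hρ a a.2)
  rw [h'] at h
  exact Set.countable_coe_iff.1 (Set.countable_univ_iff.1 h)

theorem IsAhlfors.secondCountableTopology {μ : Measure X} {c₁ c₂ ν : ℝ}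
    (hA : IsAhlfors μ c₁ c₂ ν) (hc₁ : 0 < c₁) : SecondCountableTopology X := by
  refine Metric.secondCountable_of_almost_dense_set fun ε hε => ?_
  obtain ⟨u, -, hd, hu⟩ := Vitali.exists_disjoint_subfamily_covering_enlargement_ball
    (Set.univ : Set X) id (fun _ => ε / 5) (ε / 5) (fun _ _ => le_rfl) 5 (by norm_num)
  refine ⟨u, hA.countable_of_pairwiseDisjoint_ball hc₁ (fun _ _ => by positivity) hd,
    fun x => ?_⟩
  obtain ⟨y, hy, hxy⟩ := hu x trivial
  have h := hxy (mem_ball_self (by positivity))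
  simp only [id, mem_ball] at h
  exact ⟨y, hy, by linarith⟩

theorem measurableSet_lt_maximalFn (μ : Measure X) (g : X → ℝ≥0∞) (t : ℝ≥0∞) :
    MeasurableSet {x | t < maximalFn μ g x} := by
  refine IsOpen.measurableSet (isOpen_iff_mem_nhds.2 fun x hx => ?_)
  simp only [maximalFn, Set.mem_ofPred_eq, lt_iSup_iff] at hx
  obtain ⟨z, r, hr, hxz, h⟩ := hx
  filter_upwards [isOpen_ball.mem_nhds hxz] with y hy
  simp only [maximalFn, lt_iSup_iff]
  exact ⟨z, r, hr, hy, h⟩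

omit [BorelSpace X] in
theorem average_le_maximalFn (μ : Measure X) (g : X → ℝ≥0∞) (x : X) {r : ℝ} (hr : 0 < r) :
    (μ (ball x r))⁻¹ * ∫⁻ y in ball x r, g y ∂μ ≤ maximalFn μ g x :=
  le_iSup_of_le x <| le_iSup_of_le r <| le_iSup_of_le hr <|
    le_iSup_of_le (mem_ball_self hr) le_rfl

/-- Weak type `(1,1)` bound for the maximal function. -/
theorem IsAhlfors.mul_meas_lt_maximalFn_le {μ : Measure X} {c₁ c₂ ν : ℝ}
    (hA : IsAhlfors μ c₁ c₂ ν) (hc₁ : 0 < c₁) (hc₁₂ : c₁ ≤ c₂) (hν : 0 < ν) {h : X → ℝ≥0∞}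
    (hh : ∫⁻ x, h x ∂μ ≠ ∞) {t : ℝ≥0∞} (ht : t ≠ 0) :
    t * μ {x | t < maximalFn μ h x} ≤ ENNReal.ofReal (5 ^ ν * (c₂ / c₁)) * ∫⁻ x, h x ∂μ := by
  have hc₂ : 0 < c₂ := hc₁.trans_le hc₁₂
  set I := ∫⁻ x, h x ∂μ
  let T : Set (X × ℝ) :=
    {a | 0 < a.2 ∧ t * μ (ball a.1 a.2) ≤ ∫⁻ y in ball a.1 a.2, h y ∂μ}
  have hR : ∀ a ∈ T, a.2 ≤ ((I / t).toReal / c₁) ^ (1 / ν) := by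
    rintro ⟨z, r⟩ ⟨hr, ha⟩
    simp only at hr ha ⊢
    have h1 : ENNReal.ofReal (c₁ * r ^ ν) ≤ I / t := by
      rw [ENNReal.le_div_iff_mul_le (Or.inl ht) (Or.inr hh), mul_comm]
      exact (mul_le_mul_right (hA z r hr).1 t).trans (ha.trans (setLIntegral_le_lintegral _ _))
    have h2 : c₁ * r ^ ν ≤ (I / t).toReal :=
      (ENNReal.ofReal_le_iff_le_toReal (ENNReal.div_ne_top hh ht)).1 h1
    have h3 : r ^ ν ≤ (I / t).toReal / c₁ := by
      rw [le_div_iff₀ hc₁]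
      linarith
    calc r = (r ^ ν) ^ (1 / ν) := by
            rw [← Real.rpow_mul hr.le, mul_one_div_cancel hν.ne', Real.rpow_one]
      _ ≤ _ := Real.rpow_le_rpow (by positivity) h3 (by positivity)
  obtain ⟨u, huT, hd, hu⟩ := Vitali.exists_disjoint_subfamily_covering_enlargement_ball
    T Prod.fst Prod.snd _ hR 5 (by norm_num)
  have hcount : u.Countable :=
    hA.countable_of_pairwiseDisjoint_ball hc₁ (fun a ha => (huT ha).1) hd
  have hsub : {x | t < maximalFn μ h x} ⊆ ⋃ a ∈ u, ball a.1 (5 * a.2) := by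
    intro x hx
    simp only [maximalFn, Set.mem_ofPred_eq, lt_iSup_iff] at hx
    obtain ⟨z, r, hr, hxz, hlt⟩ := hx
    have hzr : (z, r) ∈ T := by
      refine ⟨hr, ?_⟩
      have h0 := (hA.measure_ball_pos hc₁ z hr).ne'
      have h1 := (hA.measure_ball_lt_top z r).ne
      calc t * μ (ball z r) ≤ ((μ (ball z r))⁻¹ * ∫⁻ y in ball z r, h y ∂μ) * μ (ball z r) := by
            gcongr
        _ = ∫⁻ y in ball z r, h y ∂μ := by
            rw [mul_comm, ← mul_assoc, ENNReal.mul_inv_cancel h0 h1, one_mul]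
    obtain ⟨b, hb, hsubb⟩ := hu _ hzr
    exact Set.mem_biUnion hb (hsubb hxz)
  calc t * μ {x | t < maximalFn μ h x}
      ≤ t * ∑' a : u, μ (ball a.1.1 (5 * a.1.2)) := by
        gcongr
        exact (measure_mono hsub).trans (measure_biUnion_le μ hcount _)
    _ ≤ t * ∑' a : u, ENNReal.ofReal (5 ^ ν * (c₂ / c₁)) * μ (ball a.1.1 a.1.2) := by
        gcongr with a
        have ha := (huT a.2).1
        calc μ (ball a.1.1 (5 * a.1.2)) ≤ ENNReal.ofReal (c₂ * (5 * a.1.2) ^ ν) :=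
              (hA _ _ (by positivity)).2
          _ = ENNReal.ofReal (5 ^ ν * (c₂ / c₁)) * ENNReal.ofReal (c₁ * a.1.2 ^ ν) := by
              rw [← ENNReal.ofReal_mul (by positivity), Real.mul_rpow (by norm_num) ha.le]
              congr 1
              field_simp
          _ ≤ _ := by
              gcongr
              exact (hA _ _ ha).1
    _ = ENNReal.ofReal (5 ^ ν * (c₂ / c₁)) * ∑' a : u, t * μ (ball a.1.1 a.1.2) := by
        rw [ENNReal.tsum_mul_left, ENNReal.tsum_mul_left]
        ring
    _ ≤ ENNReal.ofReal (5 ^ ν * (c₂ / c₁)) * ∑' a : u, ∫⁻ y in ball a.1.1 a.1.2, h y ∂μ := by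
        gcongr with a
        exact (huT a.2).2
    _ = ENNReal.ofReal (5 ^ ν * (c₂ / c₁)) * ∫⁻ y in ⋃ a ∈ u, ball a.1 a.2, h y ∂μ := by
        rw [lintegral_biUnion hcount (fun _ _ => measurableSet_ball) hd]
    _ ≤ _ := by
        gcongr
        exact setLIntegral_le_lintegral _ _

theorem tsum_min_two_rpow_ne_top {β : ℝ} (hβ : 0 < β) :
    ∑' j : ℤ, min ((2 : ℝ≥0∞) ^ (j : ℝ)) (2 ^ (-(β * (j : ℝ)))) ≠ ∞ := by
  have hgeom : ∀ {γ : ℝ}, 0 < γ → ∑' n : ℕ, ((2 : ℝ≥0∞) ^ (-γ)) ^ n ≠ ∞ := by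
    intro γ hγ
    rw [ENNReal.tsum_geometric]
    refine ENNReal.inv_ne_top.2 (tsub_pos_of_lt ?_).ne'
    exact ENNReal.rpow_lt_one_of_one_lt_of_neg (by norm_num) (by linarith)
  rw [tsum_of_nat_of_neg_add_one ENNReal.summable ENNReal.summable]
  refine ENNReal.add_ne_top.2 ⟨ne_top_of_le_ne_top (hgeom hβ) ?_,
    ne_top_of_le_ne_top (hgeom one_pos) ?_⟩
  · refine ENNReal.tsum_le_tsum fun n => (min_le_right _ _).trans (le_of_eq ?_)
    rw [← ENNReal.rpow_natCast, ← ENNReal.rpow_mul]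
    push_cast
    ring_nf
  · refine ENNReal.tsum_le_tsum fun n => (min_le_left _ _).trans ?_
    rw [← ENNReal.rpow_natCast, ← ENNReal.rpow_mul]
    refine ENNReal.rpow_le_rpow_of_exponent_le (by norm_num) ?_
    push_cast
    linarith

theorem exists_two_rpow_lt_and_le {G : ℝ≥0∞} (h0 : G ≠ 0) (hG : G ≠ ∞) :
    ∃ n : ℤ, (2 : ℝ≥0∞) ^ (n : ℝ) < G ∧ G ≤ 2 ^ ((n : ℝ) + 1) := by
  obtain ⟨n, h1, h2⟩ := ENNReal.exists_mem_Ioc_zpow h0 hG (y := 2) (by norm_num) (by norm_num)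
  refine ⟨n, by rwa [ENNReal.rpow_intCast], ?_⟩
  rw [← ENNReal.rpow_intCast] at h2
  exact_mod_cast h2

theorem tsum_indicator_two_rpow_le {α : ℝ} (hα : 0 < α) (G : ℝ≥0∞) :
    ∑' k : ℤ, (Set.Ioi ((2 : ℝ≥0∞) ^ (k : ℝ))).indicator (fun _ => 2 ^ (α * (k : ℝ))) G ≤
      (∑' j : ℤ, min ((2 : ℝ≥0∞) ^ (j : ℝ)) (2 ^ (-(α * (j : ℝ))))) * G ^ α := by
  rcases eq_or_ne G 0 with rfl | h0
  · simp
  rcases eq_or_ne G ∞ with rfl | hG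
  · rw [ENNReal.top_rpow_of_pos hα, ENNReal.mul_top]
    · exact le_top
    · refine fun h => ?_
      have := ENNReal.tsum_eq_zero.1 h 0
      simp at this
  obtain ⟨n, h1, h2⟩ := exists_two_rpow_lt_and_le h0 hG
  rw [← (Equiv.subLeft n).tsum_eq, ← ENNReal.tsum_mul_right]
  refine ENNReal.tsum_le_tsum fun j => ?_
  by_cases hj : G ∈ Set.Ioi ((2 : ℝ≥0∞) ^ ((Equiv.subLeft n j : ℤ) : ℝ))
  swap
  · rw [Set.indicator_of_notMem hj]
    exact zero_le
  rw [Set.indicator_of_mem hj]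
  have hj0 : 0 ≤ j := by
    by_contra! hneg
    have h3 : (2 : ℝ≥0∞) ^ ((n : ℝ) + 1) ≤ 2 ^ (((n - j : ℤ)) : ℝ) := by
      refine ENNReal.rpow_le_rpow_of_exponent_le (by norm_num) ?_
      exact_mod_cast (by omega : n + 1 ≤ n - j)
    exact absurd (h2.trans h3) (not_le.2 hj)
  have hj0' : (0 : ℝ) ≤ j := by exact_mod_cast hj0
  rw [min_eq_right]
  · calc (2 : ℝ≥0∞) ^ (α * ((Equiv.subLeft n j : ℤ) : ℝ))
        = 2 ^ (-(α * (j : ℝ))) * (2 ^ (n : ℝ)) ^ α := by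
          rw [← ENNReal.rpow_mul, ← ENNReal.rpow_add _ _ (by norm_num) (by norm_num)]
          congr 1
          simp only [Equiv.subLeft_apply]
          push_cast
          ring
      _ ≤ _ := by gcongr
  · refine ENNReal.rpow_le_rpow_of_exponent_le (by norm_num) ?_
    nlinarith

theorem rpow_le_tsum_indicator_two_rpow {s : ℝ} (hs : 0 < s) (G : ℝ≥0∞) :
    G ^ s ≤ ∑' k : ℤ, (Set.Ioi ((2 : ℝ≥0∞) ^ (k : ℝ))).indicator
      (fun _ => 2 ^ (((k : ℝ) + 1) * s)) G := by
  rcases eq_or_ne G 0 with rfl | h0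
  · simp [hs]
  rcases eq_or_ne G ∞ with rfl | hG
  · refine le_top.trans ?_
    calc ∞ = ∑' _ : ℕ, (1 : ℝ≥0∞) := (ENNReal.tsum_const_eq_top_of_ne_zero one_ne_zero).symm
      _ ≤ ∑' n : ℕ, (Set.Ioi ((2 : ℝ≥0∞) ^ ((n : ℤ) : ℝ))).indicator
            (fun _ => 2 ^ ((((n : ℤ) : ℝ) + 1) * s)) ∞ := by
          refine ENNReal.tsum_le_tsum fun n => ?_
          rw [Set.indicator_of_mem (by simp)]
          exact ENNReal.one_le_rpow (by norm_num) (by push_cast; positivity)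
      _ ≤ _ := ENNReal.tsum_comp_le_tsum_of_injective Nat.cast_injective
          (fun k : ℤ => (Set.Ioi ((2 : ℝ≥0∞) ^ (k : ℝ))).indicator
            (fun _ => (2 : ℝ≥0∞) ^ (((k : ℝ) + 1) * s)) ∞)
  obtain ⟨n, h1, h2⟩ := exists_two_rpow_lt_and_le h0 hG
  refine le_trans ?_ (ENNReal.le_tsum n)
  rw [Set.indicator_of_mem (by exact h1), ENNReal.rpow_mul]
  gcongr

theorem tsum_min_geometric_le (β : ℝ) (hβ : 0 < β) (C : ℝ≥0∞) {s : ℝ≥0∞} (h0 : s ≠ 0)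
    (hs : s ≠ ∞) :
    ∑' k : ℕ, min (s * 2 ^ k) (C * (s * 2 ^ k) ^ (-β)) ≤
      (2 + C) * ∑' j : ℤ, min ((2 : ℝ≥0∞) ^ (j : ℝ)) (2 ^ (-(β * (j : ℝ)))) := by
  obtain ⟨n, h1, h2⟩ := exists_two_rpow_lt_and_le h0 hs
  rw [← ENNReal.tsum_mul_left]
  refine le_trans ?_ (ENNReal.tsum_comp_le_tsum_of_injective
    (f := fun k : ℕ => n + (k : ℤ)) (fun a b h => by simpa using h) _)
  refine ENNReal.tsum_le_tsum fun k => ?_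
  have hlow : (2 : ℝ≥0∞) ^ ((n : ℝ) + k) ≤ s * 2 ^ k := by
    rw [ENNReal.rpow_add _ _ (by norm_num) (by norm_num), ENNReal.rpow_natCast]
    gcongr
  have hup : s * 2 ^ k ≤ 2 * (2 : ℝ≥0∞) ^ ((n : ℝ) + k) := by
    calc s * 2 ^ k ≤ 2 ^ ((n : ℝ) + 1) * 2 ^ k := by gcongr
      _ = _ := by
        rw [ENNReal.rpow_add _ _ (by norm_num) (by norm_num),
          ENNReal.rpow_add _ _ (by norm_num) (by norm_num), ENNReal.rpow_natCast, ENNReal.rpow_one]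
        ring
  push_cast
  rw [mul_min]
  refine min_le_min ?_ ?_
  · refine hup.trans ?_
    gcongr
    exact le_self_add
  · refine mul_le_mul' le_add_self ?_
    rw [ENNReal.rpow_neg, mul_comm β, ENNReal.rpow_neg, ENNReal.rpow_mul]
    gcongr

theorem tsum_le_mul_rpow_mul_rpow {θ : ℝ} (hθ : 0 < θ) (hθ1 : θ < 1) (C : ℝ≥0∞)
    {s : ℝ≥0∞} (h0 : s ≠ 0) (hs : s ≠ ∞) {M N : ℝ≥0∞} (hN : N ≠ ∞) {a : ℕ → ℝ≥0∞}
    (haM : ∀ k, a k ≤ s * 2 ^ k * M)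
    (haN : ∀ k, a k ≤ C * (s * 2 ^ k) ^ (-(1 / θ - 1)) * N) :
    ∑' k, a k ≤ (2 + C) * (∑' j : ℤ, min ((2 : ℝ≥0∞) ^ (j : ℝ))
      (2 ^ (-((1 / θ - 1) * (j : ℝ))))) * M ^ (1 - θ) * N ^ θ := by
  have hβ : 0 < 1 / θ - 1 := by
    have := one_lt_one_div hθ hθ1
    linarith
  rcases eq_or_ne M 0 with rfl | hM0
  · simp only [mul_zero, nonpos_iff_eq_zero] at haM
    simp [haM]
  rcases eq_or_ne N 0 with rfl | hN0
  · simp only [mul_zero, nonpos_iff_eq_zero] at haN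
    simp [haN]
  rcases eq_or_ne M ∞ with rfl | hM
  · rw [ENNReal.top_rpow_of_pos (by linarith), ENNReal.mul_top, ENNReal.top_mul]
    · exact le_top
    · exact (ENNReal.rpow_pos (pos_iff_ne_zero.2 hN0) hN).ne'
    · refine mul_ne_zero (by simp) fun h => ?_
      have := ENNReal.tsum_eq_zero.1 h 0
      simp at this
  set β := 1 / θ - 1 with hβdef
  have hM0θ : M ^ (-θ) ≠ 0 := (ENNReal.rpow_pos (pos_iff_ne_zero.2 hM0) hM).ne'
  have hN0θ : N ^ θ ≠ 0 := (ENNReal.rpow_pos (pos_iff_ne_zero.2 hN0) hN).ne'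
  have hMθ : M ^ (-θ) ≠ ∞ := ENNReal.rpow_ne_top_of_ne_zero hM0 hM
  have hNθ : N ^ θ ≠ ∞ := ENNReal.rpow_ne_top_of_ne_zero hN0 hN
  set R := M ^ (-θ) * N ^ θ with hR
  have hR0 : R ≠ 0 := mul_ne_zero hM0θ hN0θ
  have hRt : R ≠ ∞ := ENNReal.mul_ne_top hMθ hNθ
  have hRM : R * M = M ^ (1 - θ) * N ^ θ := by
    rw [sub_eq_neg_add, ENNReal.rpow_add _ _ hM0 hM, ENNReal.rpow_one, hR]
    ring
  have hRN : R * M * R ^ β = N := by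
    have : R * R ^ β = R ^ (1 / θ) := by
      rw [hβdef, ← sub_add_cancel (1 / θ) 1, ENNReal.rpow_add _ _ hR0 hRt, ENNReal.rpow_one,
        mul_comm, add_sub_cancel_right]
    rw [mul_right_comm, this, hR, ENNReal.mul_rpow_of_ne_top hMθ hNθ, ← ENNReal.rpow_mul,
      ← ENNReal.rpow_mul, mul_one_div_cancel hθ.ne', neg_mul, mul_one_div_cancel hθ.ne',
      ENNReal.rpow_one, ENNReal.rpow_neg_one, mul_right_comm, ENNReal.inv_mul_cancel hM0 hM,
      one_mul]
  have key := tsum_min_geometric_le β hβ C (s := s / R) (ENNReal.div_ne_zero.2 ⟨h0, hRt⟩)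
    (ENNReal.div_ne_top hs hR0)
  calc ∑' k, a k
      ≤ ∑' k : ℕ, R * M * min (s / R * 2 ^ k) (C * (s / R * 2 ^ k) ^ (-β)) := by
        refine ENNReal.tsum_le_tsum fun k => ?_
        rw [mul_min]
        refine le_min ((haM k).trans (le_of_eq ?_)) ((haN k).trans (le_of_eq ?_))
        · calc s * 2 ^ k * M = s * 2 ^ k * M * (R * R⁻¹) := by
                rw [ENNReal.mul_inv_cancel hR0 hRt, mul_one]
            _ = _ := by rw [div_eq_mul_inv]; ring
        · have h2 : (s / R * 2 ^ k) ^ (-β) = (s * 2 ^ k) ^ (-β) * R ^ β := by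
            have : s / R * 2 ^ k = s * 2 ^ k * R⁻¹ := by rw [div_eq_mul_inv]; ring
            rw [this, ENNReal.mul_rpow_of_ne_top (ENNReal.mul_ne_top hs (by simp))
              (ENNReal.inv_ne_top.2 hR0), ENNReal.inv_rpow, ← ENNReal.rpow_neg, neg_neg]
          rw [h2]
          nth_rewrite 1 [← hRN]
          ring
    _ ≤ R * M * ((2 + C) * _) := by
        rw [ENNReal.tsum_mul_left]
        gcongr
    _ = _ := by
        rw [hRM]
        ring

omit [BorelSpace X] in
theorem maximalFn_indicator_lt {μ : Measure X} {g : X → ℝ≥0∞} (hg : Measurable g) {τ : ℝ≥0∞}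
    {x : X} (hx : 2 * τ < maximalFn μ g x) :
    τ < maximalFn μ ({y | τ < g y}.indicator g) x := by
  simp only [maximalFn, lt_iSup_iff] at hx ⊢
  obtain ⟨z, r, hr, hxz, hlt⟩ := hx
  refine ⟨z, r, hr, hxz, ?_⟩
  by_contra! hle
  refine absurd hlt (not_lt.2 ?_)
  have hms : MeasurableSet {y | τ < g y} := measurableSet_lt measurable_const hg
  calc (μ (ball z r))⁻¹ * ∫⁻ y in ball z r, g y ∂μ
      ≤ (μ (ball z r))⁻¹ * ∫⁻ y in ball z r, ({y | τ < g y}.indicator g y + τ) ∂μ := by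
        gcongr with y
        by_cases hy : τ < g y
        · rw [Set.indicator_of_mem (by exact hy)]
          exact le_self_add
        · exact (not_lt.1 hy).trans le_add_self
    _ = (μ (ball z r))⁻¹ * ∫⁻ y in ball z r, {y | τ < g y}.indicator g y ∂μ +
          τ * ((μ (ball z r))⁻¹ * μ (ball z r)) := by
        rw [lintegral_add_left (hg.indicator hms), setLIntegral_const, mul_add]
        ring
    _ ≤ τ + τ * 1 := by
        gcongr
        exact ENNReal.inv_mul_le_one _
    _ = 2 * τ := by ring

/-- Strong type `(s,s)` bound for the maximal function, `1 < s`. -/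
theorem IsAhlfors.lintegral_maximalFn_rpow_le {μ : Measure X} {c₁ c₂ ν : ℝ}
    (hA : IsAhlfors μ c₁ c₂ ν) (hc₁ : 0 < c₁) (hc₁₂ : c₁ ≤ c₂) (hν : 0 < ν) {g : X → ℝ≥0∞}
    (hg : Measurable g) {s : ℝ} (hs : 1 < s) (hgs : ∫⁻ x, g x ^ s ∂μ ≠ ∞) :
    ∫⁻ x, maximalFn μ g x ^ s ∂μ ≤
      2 ^ (2 * s) * ENNReal.ofReal (5 ^ ν * (c₂ / c₁)) *
        (∑' j : ℤ, min ((2 : ℝ≥0∞) ^ (j : ℝ)) (2 ^ (-((s - 1) * (j : ℝ))))) *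
        ∫⁻ x, g x ^ s ∂μ := by
  have hs0 : 0 < s - 1 := by linarith
  have hmul : ∀ a : ℝ≥0∞, a * a ^ (s - 1) = a ^ s := fun a => by
    nth_rewrite 1 [← ENNReal.rpow_one a]
    rw [← ENNReal.rpow_add_of_nonneg _ _ (by norm_num) hs0.le, add_sub_cancel]
  have hmeas : Measurable (maximalFn μ g) :=
    measurable_of_Ioi fun t => measurableSet_lt_maximalFn μ g t
  have hms : ∀ τ : ℝ≥0∞, MeasurableSet {y | τ < g y} :=
    fun τ => measurableSet_lt measurable_const hg
  have hweak : ∀ j : ℤ, (2 : ℝ≥0∞) ^ (j : ℝ) * μ {x | 2 ^ ((j : ℝ) + 1) < maximalFn μ g x} ≤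
      ENNReal.ofReal (5 ^ ν * (c₂ / c₁)) *
        ∫⁻ y, {y | (2 : ℝ≥0∞) ^ (j : ℝ) < g y}.indicator g y ∂μ := by
    intro j
    set τ : ℝ≥0∞ := 2 ^ (j : ℝ) with hτ
    have hτ0 : τ ≠ 0 := (ENNReal.rpow_pos (by norm_num) (by norm_num)).ne'
    have hfin : ∫⁻ y, {y | τ < g y}.indicator g y ∂μ ≠ ∞ := by
      have h1 : τ ^ (s - 1) * ∫⁻ y, {y | τ < g y}.indicator g y ∂μ ≤ ∫⁻ y, g y ^ s ∂μ := by
        rw [← lintegral_const_mul _ (hg.indicator (hms τ))]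
        refine lintegral_mono fun y => ?_
        by_cases hy : τ < g y
        · simp only
          rw [Set.indicator_of_mem (by exact hy), ← hmul, mul_comm]
          gcongr
        · simp only
          rw [Set.indicator_of_notMem (by exact hy)]
          simp
      refine (ENNReal.lt_top_of_mul_ne_top_right (ne_top_of_le_ne_top hgs h1) ?_).ne
      exact (ENNReal.rpow_pos (pos_iff_ne_zero.2 hτ0)
        (ENNReal.rpow_ne_top_of_ne_zero (by norm_num) (by norm_num))).ne'
    refine le_trans (mul_le_mul_right (measure_mono fun x hx => ?_) τ) (hA.mul_meas_lt_maximalFn_le hc₁ hc₁₂ hν hfin hτ0)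
    refine maximalFn_indicator_lt hg (lt_of_eq_of_lt ?_ hx)
    rw [ENNReal.rpow_add _ _ (by norm_num) (by norm_num), ENNReal.rpow_one, mul_comm]
  calc ∫⁻ x, maximalFn μ g x ^ s ∂μ
      ≤ ∫⁻ x, ∑' k : ℤ, (Set.Ioi ((2 : ℝ≥0∞) ^ (k : ℝ))).indicator
          (fun _ => 2 ^ (((k : ℝ) + 1) * s)) (maximalFn μ g x) ∂μ :=
        lintegral_mono fun x => rpow_le_tsum_indicator_two_rpow (by linarith) _
    _ = ∑' k : ℤ, (2 : ℝ≥0∞) ^ (((k : ℝ) + 1) * s) *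
          μ {x | 2 ^ (k : ℝ) < maximalFn μ g x} := by
        rw [lintegral_tsum]
        · refine tsum_congr fun k => ?_
          rw [lintegral_indicator_const_comp hmeas measurableSet_Ioi]
          rfl
        · exact fun k => ((measurable_const.indicator measurableSet_Ioi).comp hmeas).aemeasurable
    _ = ∑' j : ℤ, (2 : ℝ≥0∞) ^ (2 * s) * 2 ^ ((s - 1) * (j : ℝ)) * (2 ^ (j : ℝ) *
          μ {x | 2 ^ ((j : ℝ) + 1) < maximalFn μ g x}) := by
        rw [← (Equiv.addRight (1 : ℤ)).tsum_eq]
        refine tsum_congr fun j => ?_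
        rw [← mul_assoc, ← ENNReal.rpow_add _ _ (by norm_num) (by norm_num),
          ← ENNReal.rpow_add _ _ (by norm_num) (by norm_num)]
        simp only [Equiv.coe_addRight]
        push_cast
        congr 2
        ring
    _ ≤ ∑' j : ℤ, (2 : ℝ≥0∞) ^ (2 * s) * 2 ^ ((s - 1) * (j : ℝ)) *
          (ENNReal.ofReal (5 ^ ν * (c₂ / c₁)) *
            ∫⁻ y, {y | (2 : ℝ≥0∞) ^ (j : ℝ) < g y}.indicator g y ∂μ) := by
        exact ENNReal.tsum_le_tsum fun j => mul_le_mul_right (hweak j) _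
    _ = 2 ^ (2 * s) * ENNReal.ofReal (5 ^ ν * (c₂ / c₁)) * ∑' j : ℤ, ∫⁻ y,
          2 ^ ((s - 1) * (j : ℝ)) * {y | (2 : ℝ≥0∞) ^ (j : ℝ) < g y}.indicator g y ∂μ := by
        rw [← ENNReal.tsum_mul_left]
        refine tsum_congr fun j => ?_
        rw [lintegral_const_mul _ (hg.indicator (hms _))]
        ring
    _ = 2 ^ (2 * s) * ENNReal.ofReal (5 ^ ν * (c₂ / c₁)) * ∫⁻ y, ∑' j : ℤ,
          2 ^ ((s - 1) * (j : ℝ)) * {y | (2 : ℝ≥0∞) ^ (j : ℝ) < g y}.indicator g y ∂μ := by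
        rw [lintegral_tsum]
        exact fun j => ((hg.indicator (hms _)).const_mul _).aemeasurable
    _ ≤ 2 ^ (2 * s) * ENNReal.ofReal (5 ^ ν * (c₂ / c₁)) * ∫⁻ y,
          (∑' j : ℤ, min ((2 : ℝ≥0∞) ^ (j : ℝ)) (2 ^ (-((s - 1) * (j : ℝ))))) * g y ^ s ∂μ := by
        gcongr with y
        calc ∑' j : ℤ, 2 ^ ((s - 1) * (j : ℝ)) * {y | (2 : ℝ≥0∞) ^ (j : ℝ) < g y}.indicator g y
            = g y * ∑' j : ℤ, (Set.Ioi ((2 : ℝ≥0∞) ^ (j : ℝ))).indicator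
                (fun _ => 2 ^ ((s - 1) * (j : ℝ))) (g y) := by
              rw [← ENNReal.tsum_mul_left]
              refine tsum_congr fun j => ?_
              by_cases hy : (2 : ℝ≥0∞) ^ (j : ℝ) < g y
              · rw [Set.indicator_of_mem (by exact hy), Set.indicator_of_mem (by exact hy),
                  mul_comm]
              · rw [Set.indicator_of_notMem (by exact hy), Set.indicator_of_notMem (by exact hy),
                  mul_zero, mul_zero]
          _ ≤ g y * (_ * g y ^ (s - 1)) := by
              gcongr
              exact tsum_indicator_two_rpow_le hs0 (g y)
          _ = _ := by
              rw [← hmul]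
              ring
    _ = _ := by
        rw [lintegral_const_mul _ (hg.pow_const s)]
        ring

omit [MetricSpace X] [BorelSpace X] in
theorem average_le_average_rpow {μ : Measure X} {B : Set X} (h0 : μ B ≠ 0) (hB : μ B ≠ ∞)
    {h : X → ℝ≥0∞} (hh : AEMeasurable h μ) {p : ℝ} (hp : 1 ≤ p) :
    (μ B)⁻¹ * ∫⁻ y in B, h y ∂μ ≤ ((μ B)⁻¹ * ∫⁻ y in B, h y ^ p ∂μ) ^ (1 / p) := by
  have := ProbabilityTheory.cond_isProbabilityMeasure_of_finite h0 hB
  have hm : AEStronglyMeasurable h (ProbabilityTheory.cond μ B) :=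
    (hh.mono_ac ProbabilityTheory.cond_absolutelyContinuous).aestronglyMeasurable
  have key := eLpNorm'_le_eLpNorm'_of_exponent_le one_pos hp _ hm
  simpa [eLpNorm', ProbabilityTheory.cond, lintegral_smul_measure] using key

theorem setIntegral_kernel_Ioc_eq_zero {μ : Measure X} {c₁ c₂ ν CK : ℝ} {K : X → X → ℝ}
    (hA : IsAhlfors μ c₁ c₂ ν) (hν : 0 < ν) (hCK : 0 < CK)
    (hK : Measurable (Function.uncurry K)) (hsize : SizeCond K CK ν) (hnull : NullCond μ K)
    (x : X) {a b : ℝ} (ha : 0 < a) (hab : a < b) :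
    ∫ y in {y | a < dist x y ∧ dist x y ≤ b}, K x y ∂μ = 0 := by
  let S : ℕ → Set X := fun n => {y | a < dist x y ∧ dist x y < b + 1 / ((n : ℝ) + 1)}
  have hSm : ∀ n, MeasurableSet (S n) := fun n =>
    (measurableSet_lt measurable_const (continuous_const.dist continuous_id).measurable).inter
      (measurableSet_lt (continuous_const.dist continuous_id).measurable measurable_const)
  have hS : ⋂ n, S n = {y | a < dist x y ∧ dist x y ≤ b} := by
    ext y
    simp only [Set.mem_iInter, S, Set.mem_ofPred_eq]
    refine ⟨fun h => ⟨(h 0).1, ?_⟩, fun h n => ⟨h.1, ?_⟩⟩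
    · have ht : Filter.Tendsto (fun n : ℕ => b + 1 / ((n : ℝ) + 1)) Filter.atTop (nhds (b + 0)) :=
        tendsto_const_nhds.add tendsto_one_div_add_atTop_nhds_zero_nat
      rw [add_zero] at ht
      exact ge_of_tendsto' ht fun n => (h n).2.le
    · have : (0 : ℝ) < 1 / ((n : ℝ) + 1) := by positivity
      linarith [h.2]
  have hanti : Antitone S := by
    intro m n hmn y hy
    refine ⟨hy.1, hy.2.trans_le ?_⟩
    gcongr
  have hint : IntegrableOn (K x) (S 0) μ := by
    have hsub : S 0 ⊆ ball x (b + 2) := by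
      intro y hy
      have h2 := hy.2
      norm_num at h2
      rw [mem_ball, dist_comm]
      linarith
    refine Measure.integrableOn_of_bounded (M := CK / a ^ ν)
      (ne_top_of_le_ne_top (hA.measure_ball_lt_top x _).ne (measure_mono hsub))
      hK.of_uncurry_left.aestronglyMeasurable
      ((ae_restrict_iff' (hSm 0)).2 (Filter.Eventually.of_forall fun y hy => ?_))
    have hxy : x ≠ y := dist_pos.1 (ha.trans hy.1)
    refine (hsize x y hxy).trans ?_
    gcongr
    exact hy.1.le
  have hlim := tendsto_setIntegral_of_antitone (μ := μ) (f := K x) hSm hanti ⟨0, hint⟩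
  rw [hS] at hlim
  refine tendsto_nhds_unique hlim ?_
  have hz : ∀ n, ∫ y in S n, K x y ∂μ = 0 := fun n =>
    hnull x a _ ha (by have : (0 : ℝ) < 1 / ((n : ℝ) + 1) := by positivity
                       linarith)
  simp only [hz]
  exact tendsto_const_nhds

omit [BorelSpace X] in
theorem PoincareSobolev.average_enorm_sub_le {μ : Measure X} {c₁ c₂ ν ρ' CP σ : ℝ} {f : X → ℝ}
    {g : X → ℝ≥0∞} (hPS : PoincareSobolev μ f g ρ' CP σ) (hA : IsAhlfors μ c₁ c₂ ν)
    (hc₁ : 0 < c₁) (hρ' : 1 ≤ ρ') (hf : AEStronglyMeasurable f μ) (x : X) {r : ℝ} (hr : 0 < r) :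
    (μ (ball x r))⁻¹ * ∫⁻ y in ball x r, ‖f y - ⨍ z in ball x r, f z ∂μ‖ₑ ∂μ ≤
      ENNReal.ofReal (CP * r) *
        ((μ (ball x (σ * r)))⁻¹ * ∫⁻ y in ball x (σ * r), g y ∂μ) := by
  refine le_trans ?_ (hPS x r hr)
  refine (average_le_average_rpow (hA.measure_ball_pos hc₁ x hr).ne'
    (hA.measure_ball_lt_top x r).ne (hf.sub aestronglyMeasurable_const).enorm hρ').trans_eq ?_
  congr 3
  ext y
  rw [Pi.sub_apply, Real.enorm_eq_ofReal_abs, ENNReal.ofReal_rpow_of_nonneg (abs_nonneg _) (by linarith)]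

/-- Pointwise control of a truncated singular integral by a discrete Riesz-type potential. -/
theorem ofReal_abs_truncT_le {μ : Measure X} {c₁ c₂ ν CK CP σ ρ' : ℝ} {K : X → X → ℝ}
    {f : X → ℝ} {g : X → ℝ≥0∞} (hA : IsAhlfors μ c₁ c₂ ν) (hc₁ : 0 < c₁) (hc₁₂ : c₁ ≤ c₂)
    (hν : 0 < ν) (hCK : 0 < CK) (hK : Measurable (Function.uncurry K))
    (hsize : SizeCond K CK ν) (hnull : NullCond μ K) (hf : LocallyIntegrable f μ)
    (hg : LocIntE μ g) (hρ' : 1 ≤ ρ') (hCP : 0 < CP) (hσ : 1 ≤ σ)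
    (hPS : PoincareSobolev μ f g ρ' CP σ) {ε : ℝ} (hε : 0 < ε) (x : X) :
    ENNReal.ofReal |truncT μ K f ε x| ≤ ENNReal.ofReal (CK * c₂ * 4 ^ ν * CP) *
      ∑' k : ℕ, ENNReal.ofReal (4 * ε * 2 ^ k) *
        ((μ (ball x (σ * (4 * ε * 2 ^ k))))⁻¹ *
          ∫⁻ y in ball x (σ * (4 * ε * 2 ^ k)), g y ∂μ) := by
  have := hA.secondCountableTopology hc₁
  have hfm := hf.aestronglyMeasurable
  have hc₂ : 0 < c₂ := hc₁.trans_le hc₁₂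
  by_cases hint : IntegrableOn (fun y => K x y * f y) {y | ε < dist x y} μ
  swap
  · rw [truncT, integral_undef hint]
    simp
  let A : ℕ → Set X := fun k => {y | ε * 2 ^ k < dist x y ∧ dist x y ≤ ε * 2 ^ (k + 1)}
  have hAm : ∀ k, MeasurableSet (A k) := fun k =>
    (measurableSet_lt measurable_const (continuous_const.dist continuous_id).measurable).inter
      (measurableSet_le (continuous_const.dist continuous_id).measurable measurable_const)
  have hAd : Pairwise (Function.onFun Disjoint A) := by
    have hlt : ∀ i j : ℕ, i < j → Disjoint (A i) (A j) := by
      intro i j hij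
      rw [Set.disjoint_left]
      intro y hyi hyj
      have : ε * (2 : ℝ) ^ (i + 1) ≤ ε * 2 ^ j := by
        gcongr
        · norm_num
        · omega
      linarith [hyi.2, hyj.1]
    intro i j hij
    rcases lt_or_gt_of_ne hij with h | h
    · exact hlt i j h
    · exact (hlt j i h).symm
  have hAU : ⋃ k, A k = {y | ε < dist x y} := by
    ext y
    simp only [Set.mem_iUnion, A, Set.mem_ofPred_eq]
    constructor
    · rintro ⟨k, hk, -⟩
      refine lt_of_le_of_lt ?_ hk
      exact le_mul_of_one_le_right hε.le (one_le_pow₀ (by norm_num))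
    · intro hy
      have hex : ∃ k : ℕ, dist x y ≤ ε * 2 ^ k := by
        obtain ⟨k, hk⟩ := pow_unbounded_of_one_lt (dist x y / ε) (one_lt_two (α := ℝ))
        refine ⟨k, ?_⟩
        rw [div_lt_iff₀ hε] at hk
        linarith
      classical
      obtain ⟨k, hk, hmin⟩ : ∃ k : ℕ, dist x y ≤ ε * 2 ^ k ∧ ∀ m < k, ¬ dist x y ≤ ε * 2 ^ m :=
        ⟨Nat.find hex, Nat.find_spec hex, fun m hm => Nat.find_min hex hm⟩
      cases k with
      | zero => simp at hk; linarith
      | succ k => exact ⟨k, not_le.1 (hmin k (by omega)), hk⟩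
  rw [← hAU] at hint
  rw [← Real.enorm_eq_ofReal_abs, truncT, ← hAU,
    ← (hasSum_integral_iUnion hAm hAd hint).tsum_eq, ← ENNReal.tsum_mul_left]
  refine enorm_tsum_le_tsum_enorm.trans (ENNReal.tsum_le_tsum fun k => ?_)
  set a : ℝ := ε * 2 ^ k with ha_def
  have ha : 0 < a := by positivity
  have hAk : A k = {y | a < dist x y ∧ dist x y ≤ 2 * a} := by
    simp only [A, ha_def, pow_succ]
    congr! 4
    ring
  have h4 : 4 * ε * 2 ^ k = 4 * a := by rw [ha_def]; ring
  rw [h4]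
  have hr : 0 < 4 * a := by positivity
  set B := ball x (4 * a) with hB
  have hAB : A k ⊆ B := by
    intro y hy
    rw [hAk] at hy
    rw [hB, mem_ball, dist_comm]
    linarith [hy.2]
  set c := ⨍ z in B, f z ∂μ
  have hB0 : μ B ≠ 0 := (hA.measure_ball_pos hc₁ x hr).ne'
  have hBt : μ B ≠ ∞ := (hA.measure_ball_lt_top x _).ne
  have hosc := hPS.average_enorm_sub_le hA hc₁ hρ' hfm x hr
  set Q := (μ (ball x (σ * (4 * a))))⁻¹ * ∫⁻ y in ball x (σ * (4 * a)), g y ∂μ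
  have hQ : Q ≠ ∞ := ENNReal.mul_ne_top
    (ENNReal.inv_ne_top.2 (hA.measure_ball_pos hc₁ x (by positivity)).ne') (hg.2 _ _).ne
  have hosc' : ∫⁻ y in B, ‖f y - c‖ₑ ∂μ ≤ μ B * (ENNReal.ofReal (CP * (4 * a)) * Q) := by
    calc ∫⁻ y in B, ‖f y - c‖ₑ ∂μ = μ B * ((μ B)⁻¹ * ∫⁻ y in B, ‖f y - c‖ₑ ∂μ) := by
          rw [← mul_assoc, ENNReal.mul_inv_cancel hB0 hBt, one_mul]
      _ ≤ _ := by gcongr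
  have hfc : IntegrableOn (fun y => f y - c) (A k) μ := by
    refine IntegrableOn.mono_set ⟨(hfm.sub aestronglyMeasurable_const).restrict, ?_⟩ hAB
    exact hosc'.trans_lt (ENNReal.mul_lt_top hBt.lt_top
      (ENNReal.mul_lt_top ENNReal.ofReal_lt_top hQ.lt_top))
  have hKb : ∀ y ∈ A k, ‖K x y‖ ≤ CK / a ^ ν := by
    intro y hy
    rw [hAk] at hy
    refine (hsize x y (dist_pos.1 (ha.trans hy.1))).trans ?_
    gcongr
    exact hy.1.le
  have hKb' : ∀ᵐ y ∂μ.restrict (A k), ‖K x y‖ ≤ CK / a ^ ν :=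
    (ae_restrict_iff' (hAm k)).2 (Filter.Eventually.of_forall hKb)
  have hKm : AEStronglyMeasurable (K x) μ := hK.of_uncurry_left.aestronglyMeasurable
  have hKfc : IntegrableOn (fun y => K x y * (f y - c)) (A k) μ :=
    Integrable.bdd_mul hfc hKm.restrict hKb'
  have hKi : IntegrableOn (K x) (A k) μ :=
    Measure.integrableOn_of_bounded (ne_top_of_le_ne_top hBt (measure_mono hAB)) hKm hKb'
  have heq : ∫ y in A k, K x y * f y ∂μ = ∫ y in A k, K x y * (f y - c) ∂μ := by
    have h1 : ∫ y in A k, K x y * c ∂μ = 0 := by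
      rw [integral_mul_const, hAk,
        setIntegral_kernel_Ioc_eq_zero hA hν hCK hK hsize hnull x ha (by linarith), zero_mul]
    calc ∫ y in A k, K x y * f y ∂μ = ∫ y in A k, (K x y * (f y - c) + K x y * c) ∂μ := by
          congr 1
          ext y
          ring
      _ = _ := by rw [integral_add hKfc (hKi.mul_const c), h1, add_zero]
  rw [heq]
  calc ‖∫ y in A k, K x y * (f y - c) ∂μ‖ₑ
      ≤ ∫⁻ y in A k, ‖K x y * (f y - c)‖ₑ ∂μ := enorm_integral_le_lintegral_enorm _
    _ ≤ ∫⁻ y in A k, ENNReal.ofReal (CK / a ^ ν) * ‖f y - c‖ₑ ∂μ := by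
        refine setLIntegral_mono' (hAm k) fun y hy => ?_
        rw [enorm_mul]
        gcongr
        rw [← ofReal_norm]
        exact ENNReal.ofReal_le_ofReal (hKb y hy)
    _ ≤ ∫⁻ y in B, ENNReal.ofReal (CK / a ^ ν) * ‖f y - c‖ₑ ∂μ := lintegral_mono_set hAB
    _ = ENNReal.ofReal (CK / a ^ ν) * ∫⁻ y in B, ‖f y - c‖ₑ ∂μ :=
        lintegral_const_mul' _ _ ENNReal.ofReal_ne_top
    _ ≤ ENNReal.ofReal (CK / a ^ ν) *
          (ENNReal.ofReal (c₂ * (4 * a) ^ ν) * (ENNReal.ofReal (CP * (4 * a)) * Q)) := by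
        gcongr
        refine hosc'.trans ?_
        gcongr
        exact (hA x _ hr).2
    _ = _ := by
        have : a ^ ν ≠ 0 := (Real.rpow_pos_of_pos ha ν).ne'
        have hconst : CK / a ^ ν * (c₂ * (4 ^ ν * a ^ ν)) * (CP * (4 * a)) =
            CK * c₂ * 4 ^ ν * CP * (4 * a) := by
          field_simp
        rw [← mul_assoc (ENNReal.ofReal (CK / a ^ ν)), ← mul_assoc _ _ Q, ← mul_assoc _ _ Q,
          ← ENNReal.ofReal_mul (by positivity), ← ENNReal.ofReal_mul (by positivity),
          ← ENNReal.ofReal_mul (by positivity), Real.mul_rpow (by norm_num) ha.le, hconst]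

omit [BorelSpace X] in
theorem morreyNorm_ball_le (μ : Measure X) (p q : ℝ) (g : X → ℝ≥0∞) (x : X) {r : ℝ}
    (hr : 0 < r) :
    (μ (ball x r) ^ (p / q - 1) * ∫⁻ y in ball x r, g y ^ p ∂μ) ^ (1 / p) ≤ morreyNorm μ p q g :=
  le_iSup_of_le x <| le_iSup_of_le r <| le_iSup_of_le hr le_rfl

omit [BorelSpace X] in
theorem average_le_morreyNorm {μ : Measure X} {c₁ c₂ ν p q : ℝ} {g : X → ℝ≥0∞}
    (hA : IsAhlfors μ c₁ c₂ ν) (hc₁ : 0 < c₁) (hp : 1 ≤ p) (hpq : p ≤ q) (hg : Measurable g)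
    (x : X) {r : ℝ} (hr : 0 < r) :
    (μ (ball x r))⁻¹ * ∫⁻ y in ball x r, g y ∂μ ≤
      ENNReal.ofReal c₁ ^ (-(1 / q)) * ENNReal.ofReal r ^ (-(ν / q)) * morreyNorm μ p q g := by
  have hp0 : 0 < p := by linarith
  have hq0 : 0 < q := by linarith
  have h0 := (hA.measure_ball_pos hc₁ x hr).ne'
  have ht := (hA.measure_ball_lt_top x r).ne
  set m := μ (ball x r)
  calc m⁻¹ * ∫⁻ y in ball x r, g y ∂μ
      ≤ (m⁻¹ * ∫⁻ y in ball x r, g y ^ p ∂μ) ^ (1 / p) :=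
        average_le_average_rpow h0 ht hg.aemeasurable hp
    _ = m ^ (-(1 / q)) * (m ^ (p / q - 1) * ∫⁻ y in ball x r, g y ^ p ∂μ) ^ (1 / p) := by
        have h1 : m ^ (-(1 / q)) = (m ^ (-(p / q))) ^ (1 / p) := by
          rw [← ENNReal.rpow_mul]
          congr 1
          field_simp
        rw [h1, ← ENNReal.mul_rpow_of_nonneg _ _ (by positivity), ← mul_assoc,
          ← ENNReal.rpow_add _ _ h0 ht, ← ENNReal.rpow_neg_one]
        congr 3
        ring
    _ ≤ _ := by
        gcongr
        · have h2 : ENNReal.ofReal c₁ * ENNReal.ofReal r ^ ν ≤ m := by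
            rw [ENNReal.ofReal_rpow_of_pos hr, ← ENNReal.ofReal_mul hc₁.le]
            exact (hA x r hr).1
          calc m ^ (-(1 / q)) ≤ (ENNReal.ofReal c₁ * ENNReal.ofReal r ^ ν) ^ (-(1 / q)) := by
                rw [ENNReal.rpow_neg, ENNReal.rpow_neg]
                gcongr
            _ = _ := by
                rw [ENNReal.mul_rpow_of_ne_top ENNReal.ofReal_ne_top
                  (ENNReal.rpow_ne_top_of_ne_zero (ENNReal.ofReal_pos.2 hr).ne'
                    ENNReal.ofReal_ne_top), ← ENNReal.rpow_mul]
                congr 2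
                ring
        · exact morreyNorm_ball_le μ p q g x hr

omit [BorelSpace X] in
/-- Hedberg-type estimate for a discrete Riesz potential of order one. -/
theorem tsum_mul_average_le {μ : Measure X} {c₁ c₂ ν p q : ℝ} {g : X → ℝ≥0∞}
    (hA : IsAhlfors μ c₁ c₂ ν) (hc₁ : 0 < c₁) (hν : 0 < ν) (hp : 1 ≤ p) (hpq : p ≤ q)
    (hqν : q / ν < 1) (hg : Measurable g) (hgM : morreyNorm μ p q g ≠ ∞) (x : X) {s : ℝ}
    (hs : 0 < s) :
    ∑' k : ℕ, ENNReal.ofReal (s * 2 ^ k) *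
        ((μ (ball x (s * 2 ^ k)))⁻¹ * ∫⁻ y in ball x (s * 2 ^ k), g y ∂μ) ≤
      (2 + ENNReal.ofReal c₁ ^ (-(1 / q))) *
        (∑' j : ℤ, min ((2 : ℝ≥0∞) ^ (j : ℝ)) (2 ^ (-((1 / (q / ν) - 1) * (j : ℝ))))) *
        maximalFn μ g x ^ (1 - q / ν) * morreyNorm μ p q g ^ (q / ν) := by
  have hq0 : 0 < q := by linarith
  have hcast : ∀ k : ℕ, ENNReal.ofReal (s * 2 ^ k) = ENNReal.ofReal s * 2 ^ k := fun k => by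
    rw [ENNReal.ofReal_mul hs.le, ENNReal.ofReal_pow (by norm_num), ENNReal.ofReal_ofNat]
  refine tsum_le_mul_rpow_mul_rpow (by positivity) hqν _ (ENNReal.ofReal_pos.2 hs).ne'
    ENNReal.ofReal_ne_top hgM (fun k => ?_) (fun k => ?_)
  · rw [← hcast]
    gcongr
    exact average_le_maximalFn μ g x (by positivity)
  · have hsk : 0 < s * 2 ^ k := by positivity
    rw [← hcast]
    refine (mul_le_mul_right (average_le_morreyNorm hA hc₁ hp hpq hg x hsk) _).trans_eq ?_
    have h1 : ENNReal.ofReal (s * 2 ^ k) ^ (-(1 / (q / ν) - 1)) =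
        ENNReal.ofReal (s * 2 ^ k) * ENNReal.ofReal (s * 2 ^ k) ^ (-(ν / q)) := by
      nth_rewrite 2 [← ENNReal.rpow_one (ENNReal.ofReal (s * 2 ^ k))]
      rw [← ENNReal.rpow_add _ _ (ENNReal.ofReal_pos.2 hsk).ne' ENNReal.ofReal_ne_top,
        one_div_div]
      congr 1
      ring
    rw [h1]
    ring

theorem maxT_le {μ : Measure X} {c₁ c₂ ν CK CP σ ρ' p q : ℝ} {K : X → X → ℝ}
    {f : X → ℝ} {g : X → ℝ≥0∞} (hA : IsAhlfors μ c₁ c₂ ν) (hc₁ : 0 < c₁) (hc₁₂ : c₁ ≤ c₂)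
    (hν : 0 < ν) (hCK : 0 < CK) (hK : Measurable (Function.uncurry K))
    (hsize : SizeCond K CK ν) (hnull : NullCond μ K) (hf : LocallyIntegrable f μ)
    (hg : LocIntE μ g) (hρ' : 1 ≤ ρ') (hCP : 0 < CP) (hσ : 1 ≤ σ)
    (hPS : PoincareSobolev μ f g ρ' CP σ) (hp : 1 ≤ p) (hpq : p ≤ q) (hqν : q / ν < 1)
    (hgM : morreyNorm μ p q g ≠ ∞) (x : X) :
    maxT μ K f x ≤ ENNReal.ofReal (CK * c₂ * 4 ^ ν * CP) *
      ((2 + ENNReal.ofReal c₁ ^ (-(1 / q))) *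
        (∑' j : ℤ, min ((2 : ℝ≥0∞) ^ (j : ℝ)) (2 ^ (-((1 / (q / ν) - 1) * (j : ℝ)))))) *
        (maximalFn μ g x ^ (1 - q / ν) * morreyNorm μ p q g ^ (q / ν)) := by
  refine iSup₂_le fun ε hε => ?_
  refine (ofReal_abs_truncT_le hA hc₁ hc₁₂ hν hCK hK hsize hnull hf hg hρ' hCP hσ hPS hε x).trans
    ?_
  rw [mul_assoc (ENNReal.ofReal _), ← mul_assoc _ (_ ^ _)]
  refine mul_le_mul_right (le_trans (ENNReal.tsum_le_tsum fun k => ?_)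
    (tsum_mul_average_le hA hc₁ hν hp hpq hqν hg.1 hgM x (s := σ * (4 * ε)) (by positivity))) _
  rw [mul_assoc σ]
  have hε' : 0 < ε := hε
  exact mul_le_mul' (ENNReal.ofReal_le_ofReal
    (le_mul_of_one_le_left (by positivity) hσ)) le_rfl

/-- Lebesgue-space functional inequality (21) of the paper:
`‖T^*_K f‖_{L^r} ≤ C ‖g‖_{L^{(1-q/ν)r}}^{1-q/ν} ‖g‖_{M^{p,q}}^{q/ν}`. -/
theorem lebesgue_functional_inequality
    (μ : Measure X) (c₁ c₂ ν CK CP σ ρ' : ℝ) (K : X → X → ℝ) (f : X → ℝ) (g : X → ℝ≥0∞)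
    (hc₁ : 0 < c₁) (hc₁₂ : c₁ ≤ c₂) (hν : 0 < ν) (hA : IsAhlfors μ c₁ c₂ ν)
    (hbal : (2 : ℝ) ^ (1 - ν) * (c₂ / c₁) < 1)
    (hK : Measurable (Function.uncurry K)) (hCK : 0 < CK)
    (hsize : SizeCond K CK ν) (hnull : NullCond μ K)
    (hf : LocallyIntegrable f μ) (hg : LocIntE μ g)
    (hρ'1 : 1 < ρ') (hρ'ν : ρ' < ν) (hCP : 0 < CP) (hσ : 1 ≤ σ)
    (hPS : PoincareSobolev μ f g ρ' CP σ)
    (p q r : ℝ) (hp : 1 < p) (hpq : p ≤ q) (hqν : q / ν < 1)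
    (hgM : morreyNorm μ p q g < ∞)
    (hr : 1 < r) (hr' : 1 < (1 - q / ν) * r)
    (hgL : ∫⁻ x, g x ^ ((1 - q / ν) * r) ∂μ < ∞) :
    ∃ C : ℝ, 0 < C ∧
      lpNormE μ r (maxT μ K f) ≤
        ENNReal.ofReal C * lpNormE μ ((1 - q / ν) * r) g ^ (1 - q / ν) *
          morreyNorm μ p q g ^ (q / ν) := by
  have hq0 : 0 < q := by linarith
  have hθ0 : 0 < q / ν := by positivity
  have hθ1 : 0 < 1 - q / ν := by linarith
  have hr0 : 0 < r := by linarith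
  have hβ : 0 < 1 / (q / ν) - 1 := by
    have := one_lt_one_div hθ0 hqν
    linarith
  have hpt := maxT_le hA hc₁ hc₁₂ hν hCK hK hsize hnull hf hg hρ'1.le hCP hσ hPS hp.le hpq hqν
    hgM.ne
  have hmax := hA.lintegral_maximalFn_rpow_le hc₁ hc₁₂ hν hg.1 hr' hgL.ne
  have hD₁ : ENNReal.ofReal (CK * c₂ * 4 ^ ν * CP) * ((2 + ENNReal.ofReal c₁ ^ (-(1 / q))) *
      (∑' j : ℤ, min ((2 : ℝ≥0∞) ^ (j : ℝ)) (2 ^ (-((1 / (q / ν) - 1) * (j : ℝ)))))) ≠ ∞ :=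
    ENNReal.mul_ne_top ENNReal.ofReal_ne_top (ENNReal.mul_ne_top (ENNReal.add_ne_top.2
      ⟨by norm_num, ENNReal.rpow_ne_top_of_ne_zero (ENNReal.ofReal_pos.2 hc₁).ne'
        ENNReal.ofReal_ne_top⟩) (tsum_min_two_rpow_ne_top hβ))
  have hD₂ : 2 ^ (2 * ((1 - q / ν) * r)) * ENNReal.ofReal (5 ^ ν * (c₂ / c₁)) *
      (∑' j : ℤ, min ((2 : ℝ≥0∞) ^ (j : ℝ)) (2 ^ (-(((1 - q / ν) * r - 1) * (j : ℝ))))) ≠ ∞ :=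
    ENNReal.mul_ne_top (ENNReal.mul_ne_top (ENNReal.rpow_ne_top_of_ne_zero (by norm_num)
      (by norm_num)) ENNReal.ofReal_ne_top) (tsum_min_two_rpow_ne_top (by linarith))
  generalize ENNReal.ofReal (CK * c₂ * 4 ^ ν * CP) * ((2 + ENNReal.ofReal c₁ ^ (-(1 / q))) *
      (∑' j : ℤ, min ((2 : ℝ≥0∞) ^ (j : ℝ)) (2 ^ (-((1 / (q / ν) - 1) * (j : ℝ)))))) = D₁
    at hpt hD₁
  generalize 2 ^ (2 * ((1 - q / ν) * r)) * ENNReal.ofReal (5 ^ ν * (c₂ / c₁)) *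
      (∑' j : ℤ, min ((2 : ℝ≥0∞) ^ (j : ℝ)) (2 ^ (-(((1 - q / ν) * r - 1) * (j : ℝ))))) = D₂
    at hmax hD₂
  set N := morreyNorm μ p q g
  have hNr : N ^ (q / ν) ≠ ∞ := ENNReal.rpow_ne_top_of_nonneg hθ0.le hgM.ne
  have hD : D₁ * D₂ ^ (1 / r) ≠ ∞ :=
    ENNReal.mul_ne_top hD₁ (ENNReal.rpow_ne_top_of_nonneg (by positivity) hD₂)
  have hbound : lpNormE μ r (maxT μ K f) ≤
      D₁ * D₂ ^ (1 / r) * lpNormE μ ((1 - q / ν) * r) g ^ (1 - q / ν) * N ^ (q / ν) := by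
    calc lpNormE μ r (maxT μ K f)
        ≤ (∫⁻ x, (D₁ * N ^ (q / ν)) ^ r * maximalFn μ g x ^ ((1 - q / ν) * r) ∂μ) ^ (1 / r) := by
          rw [lpNormE]
          gcongr with x
          calc maxT μ K f x ^ r
              ≤ (D₁ * N ^ (q / ν) * maximalFn μ g x ^ (1 - q / ν)) ^ r := by
                gcongr
                refine (hpt x).trans_eq ?_
                ring
            _ = _ := by rw [ENNReal.mul_rpow_of_nonneg _ _ hr0.le, ← ENNReal.rpow_mul]
      _ ≤ ((D₁ * N ^ (q / ν)) ^ r * (D₂ * ∫⁻ x, g x ^ ((1 - q / ν) * r) ∂μ)) ^ (1 / r) := by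
          rw [lintegral_const_mul' _ _
            (ENNReal.rpow_ne_top_of_nonneg hr0.le (ENNReal.mul_ne_top hD₁ hNr))]
          gcongr
      _ = _ := by
          rw [ENNReal.mul_rpow_of_nonneg _ _ (by positivity), ← ENNReal.rpow_mul,
            mul_one_div_cancel hr0.ne', ENNReal.rpow_one,
            ENNReal.mul_rpow_of_nonneg _ _ (by positivity), lpNormE, ← ENNReal.rpow_mul]
          have : 1 / ((1 - q / ν) * r) * (1 - q / ν) = 1 / r := by
            rw [one_div, mul_inv, mul_right_comm, inv_mul_cancel₀ hθ1.ne', one_mul, one_div]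
          rw [this]
          ring
  refine ⟨(D₁ * D₂ ^ (1 / r)).toReal + 1, by positivity, hbound.trans ?_⟩
  gcongr
  rw [ENNReal.ofReal_add ENNReal.toReal_nonneg one_pos.le, ENNReal.ofReal_toReal hD]
  exact le_self_add
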